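/- The commutator [D_α + D′_α, Y_+] equals Y_+ Λ_Y on 𝒫_Y: for every f ∈ 𝒫_Y, (D_α + D′_α)(Y_+ f) − Y_+((D_α + D′_α) f) = Y_+(Λ_Y f). -/

import Mathlib

open MvPolynomial

noncomputable section

/-- The base field `K = ℚ(b)`: rational functions in an indeterminate `b` over `ℚ`. -/
abbrev K : Type := RatFunc ℚ

/-- The indeterminate `b ∈ K`. -/
def bb : K := RatFunc.X

/-- `α = 1 + b`. -/
def alpha : K := 1 + bb

/-- Variables: `p i` (used for `i ≥ 1`) and `y i` (used for `i ≥ 0`). -/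
inductive Var : Type
  | p : ℕ → Var
  | y : ℕ → Var
  deriving DecidableEq

/-- The ambient polynomial ring `R = K[p₁, p₂, …, y₀, y₁, …]`. -/
abbrev R : Type := MvPolynomial Var K

/-- The variable `p_i`. -/
def P (i : ℕ) : R := X (Var.p i)

/-- The variable `y_i`. -/
def Y (i : ℕ) : R := X (Var.y i)

/-- Partial derivative `∂/∂p_i`. -/
def dP (i : ℕ) (f : R) : R := pderiv (Var.p i) f

/-- Partial derivative `∂/∂y_i`. -/
def dY (i : ℕ) (f : R) : R := pderiv (Var.y i) f

/-- `𝒫`: the subalgebra of polynomials in the `p`-variables only. -/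
def Psub : Subalgebra K R := MvPolynomial.supported K (Set.range Var.p)

/-- `𝒫_Y`: the `K`-linear span of the monomials `p_λ` and `y_i·p_λ`. -/
def PY : Submodule K R :=
  Submodule.span K ((Psub : Set R) ∪ {g : R | ∃ i : ℕ, ∃ f ∈ (Psub : Set R), g = Y i * f})

/-- The Laplace–Beltrami operator
`D_α = (1/2)(α Σ_{i,j≥1} i j p_{i+j} ∂²/∂p_i∂p_j + Σ_{i,j≥1} (i+j) p_i p_j ∂/∂p_{i+j}
        + b Σ_{i≥1} i(i−1) p_i ∂/∂p_i)`. -/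
def Dalpha (f : R) : R :=
  (2 : K)⁻¹ •
    (alpha • (∑ᶠ (i : ℕ) (j : ℕ), (((i + 1) * (j + 1) : ℕ) : K) •
        (P (i + 1 + (j + 1)) * dP (i + 1) (dP (j + 1) f)))
      + (∑ᶠ (i : ℕ) (j : ℕ), (((i + 1) + (j + 1) : ℕ) : K) •
        (P (i + 1) * P (j + 1) * dP (i + 1 + (j + 1)) f))
      + bb • (∑ᶠ (i : ℕ), (((i + 1) * i : ℕ) : K) • (P (i + 1) * dP (i + 1) f)))

/-- `Λ_Y = α Σ_{i,j≥1} i y_{i+j−1} ∂²/∂p_i∂y_{j−1} + Σ_{i,j≥1} y_{i−1} p_j ∂/∂y_{i+j−1}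
      + b Σ_{i≥1} i y_i ∂/∂y_i`. -/
def LamY (f : R) : R :=
  alpha • (∑ᶠ (i : ℕ) (j : ℕ), ((i + 1 : ℕ) : K) • (Y (i + j + 1) * dP (i + 1) (dY j f)))
    + (∑ᶠ (i : ℕ) (j : ℕ), Y i * P (j + 1) * dY (i + j + 1) f)
    + bb • (∑ᶠ (i : ℕ), ((i + 1 : ℕ) : K) • (Y (i + 1) * dY (i + 1) f))

/-- `Y_+ = Σ_{i≥0} y_{i+1} ∂/∂y_i`. -/
def Yplus (f : R) : R := ∑ᶠ (i : ℕ), Y (i + 1) * dY i f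

/-- `Θ_Y = Σ_{i≥1} p_i ∂/∂y_i`. -/
def ThetaY (f : R) : R := ∑ᶠ (i : ℕ), P (i + 1) * dY (i + 1) f

/-- `A j` is the operator `A_{j+1}` of the paper:
`A_{j+1} f = (1/(1+b))·Θ_Y(Y_+(Λ_Y^j(y₀·f)))`. -/
def A (j : ℕ) (f : R) : R := (1 + bb)⁻¹ • ThetaY (Yplus (LamY^[j] (Y 0 * f)))

/-- `D'_α = α Σ_{i,j≥1} i j y_{i+j} ∂²/∂y_i∂p_j + Σ_{i,j≥1} i y_i p_j ∂/∂y_{i+j}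
      + (b/2) Σ_{i≥1} i(i−1) y_i ∂/∂y_i`. -/
def D'alpha (f : R) : R :=
  alpha • (∑ᶠ (i : ℕ) (j : ℕ), (((i + 1) * (j + 1) : ℕ) : K) •
      (Y (i + 1 + (j + 1)) * dY (i + 1) (dP (j + 1) f)))
    + (∑ᶠ (i : ℕ) (j : ℕ), ((i + 1 : ℕ) : K) • (Y (i + 1) * P (j + 1) * dY (i + 1 + (j + 1)) f))
    + (bb * (2 : K)⁻¹) • (∑ᶠ (i : ℕ), (((i + 1) * i : ℕ) : K) • (Y (i + 1) * dY (i + 1) f))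

/-- All partial derivatives of `f` of index at least `N` vanish. -/
def DerivBound (N : ℕ) (f : R) : Prop := ∀ i, N ≤ i → dP i f = 0 ∧ dY i f = 0

/-- The polynomial `f` has vanishing `y`-derivatives. -/
def YFree (f : R) : Prop := ∀ i, dY i f = 0

lemma DerivBound.mono {M N : ℕ} {f : R} (h : DerivBound M f) (hMN : M ≤ N) : DerivBound N f :=
  fun i hi => h i (hMN.trans hi)

lemma exists_derivBound (f : R) : ∃ N, DerivBound N f := by
  classical
  let g : Var → ℕ := fun v => match v with
    | Var.p i => i
    | Var.y i => i
  have key : ∀ v, f.vars.sup g + 1 ≤ g v → pderiv v f = 0 := fun v hv =>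
    pderiv_eq_zero_of_notMem_vars fun hmem => by
      have := Finset.le_sup (f := g) hmem
      omega
  exact ⟨f.vars.sup g + 1, fun i hi => ⟨key (Var.p i) hi, key (Var.y i) hi⟩⟩

@[simp] lemma dP_zero (i : ℕ) : dP i 0 = 0 := map_zero _

@[simp] lemma dY_zero (i : ℕ) : dY i 0 = 0 := map_zero _

@[simp] lemma dP_add (i : ℕ) (f g : R) : dP i (f + g) = dP i f + dP i g := map_add _ _ _

@[simp] lemma dY_add (i : ℕ) (f g : R) : dY i (f + g) = dY i f + dY i g := map_add _ _ _

@[simp] lemma dP_smul (i : ℕ) (c : K) (f : R) : dP i (c • f) = c • dP i f :=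
  Derivation.map_smul _ _ _

@[simp] lemma dY_smul (i : ℕ) (c : K) (f : R) : dY i (c • f) = c • dY i f :=
  Derivation.map_smul _ _ _

@[simp] lemma dY_sum {ι : Type*} (i : ℕ) (s : Finset ι) (f : ι → R) :
    dY i (∑ j ∈ s, f j) = ∑ j ∈ s, dY i (f j) := map_sum _ _ _

lemma pderiv_pderiv_comm (u v : Var) (f : R) :
    pderiv u (pderiv v f) = pderiv v (pderiv u f) := by
  have h : ⁅pderiv (R := K) u, pderiv (R := K) v⁆ = 0 := by
    ext w : 1
    simp only [Derivation.commutator_apply, pderiv_X, Derivation.zero_apply]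
    simp only [Pi.single_apply]
    split_ifs <;> simp
  have := congrArg (fun D : Derivation K R R => D f) h
  simpa only [Derivation.commutator_apply, Derivation.zero_apply, sub_eq_zero] using this

lemma dP_comm (i j : ℕ) (f : R) : dP i (dP j f) = dP j (dP i f) :=
  pderiv_pderiv_comm _ _ f

lemma dP_dY_comm (i j : ℕ) (f : R) : dP i (dY j f) = dY j (dP i f) :=
  pderiv_pderiv_comm _ _ f

lemma dP_Y_mul (i k : ℕ) (f : R) : dP i (Y k * f) = Y k * dP i f := by
  simp [dP, Y, Derivation.leibniz, pderiv_X]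

lemma dY_P_mul (i k : ℕ) (f : R) : dY i (P k * f) = P k * dY i f := by
  simp [dY, P, Derivation.leibniz, pderiv_X]

lemma YFree.dY_Y_mul {f : R} (hf : YFree f) (i k : ℕ) :
    dY i (Y k * f) = if i = k then f else 0 := by
  have := hf i
  unfold dY at this
  split_ifs with h
  · subst h
    simp [dY, Y, Derivation.leibniz, this]
  · simp [dY, Y, Derivation.leibniz, this, pderiv_X, h]

lemma YFree.dP {f : R} (hf : YFree f) (i : ℕ) : YFree (dP i f) := fun j => by
  rw [← dP_dY_comm, hf j, dP_zero]

lemma YFree.P_mul {f : R} (hf : YFree f) (i : ℕ) : YFree (P i * f) := fun j => by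
  rw [dY_P_mul, hf j, mul_zero]

lemma YFree.add {f g : R} (hf : YFree f) (hg : YFree g) : YFree (f + g) := fun j => by
  rw [dY_add, hf j, hg j, add_zero]

lemma YFree.smul {f : R} (hf : YFree f) (c : K) : YFree (c • f) := fun j => by
  rw [dY_smul, hf j, smul_zero]

lemma YFree.sum {ι : Type*} {s : Finset ι} {f : ι → R} (hf : ∀ i, YFree (f i)) :
    YFree (∑ i ∈ s, f i) := fun j => by
  rw [dY_sum]
  exact Finset.sum_eq_zero fun i _ => hf i j

lemma yFree_of_mem_Psub {f : R} (hf : f ∈ Psub) : YFree f := fun i => by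
  refine pderiv_eq_zero_of_notMem_vars fun h => ?_
  obtain ⟨j, hj⟩ := mem_supported.mp hf h
  cases hj

lemma finsum_eq_sum_range {N : ℕ} {F : ℕ → R} (h : ∀ i, N ≤ i → F i = 0) :
    ∑ᶠ i, F i = ∑ i ∈ Finset.range N, F i :=
  finsum_eq_sum_of_support_subset F fun i hi => by
    simpa using not_le.mp fun hN => hi (h i hN)

lemma finsum_finsum_eq_sum_range {N : ℕ} {F : ℕ → ℕ → R}
    (h : ∀ i j, N ≤ i ∨ N ≤ j → F i j = 0) :
    ∑ᶠ (i : ℕ) (j : ℕ), F i j = ∑ i ∈ Finset.range N, ∑ j ∈ Finset.range N, F i j := by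
  rw [finsum_eq_sum_range fun i hi => by simp [h i _ (Or.inl hi)]]
  exact Finset.sum_congr rfl fun i _ => finsum_eq_sum_range fun j hj => h i j (Or.inr hj)

section

variable {N : ℕ} {f : R}

lemma Yplus_eq_sum (h : DerivBound N f) :
    Yplus f = ∑ i ∈ Finset.range N, Y (i + 1) * dY i f :=
  finsum_eq_sum_range fun i hi => by rw [(h i hi).2, mul_zero]

lemma Dalpha_eq_sum (h : DerivBound N f) :
    Dalpha f = (2 : K)⁻¹ •
      (alpha • (∑ i ∈ Finset.range N, ∑ j ∈ Finset.range N, (((i + 1) * (j + 1) : ℕ) : K) •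
        (P (i + 1 + (j + 1)) * dP (i + 1) (dP (j + 1) f)))
      + (∑ i ∈ Finset.range N, ∑ j ∈ Finset.range N, (((i + 1) + (j + 1) : ℕ) : K) •
        (P (i + 1) * P (j + 1) * dP (i + 1 + (j + 1)) f))
      + bb • (∑ i ∈ Finset.range N, (((i + 1) * i : ℕ) : K) • (P (i + 1) * dP (i + 1) f))) := by
  unfold Dalpha
  rw [finsum_finsum_eq_sum_range (N := N), finsum_finsum_eq_sum_range (N := N),
    finsum_eq_sum_range (N := N)]
  · intro i hi
    simp [(h (i + 1) (by omega)).1]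
  · intro i j hij
    simp [(h (i + 1 + (j + 1)) (by omega)).1]
  · rintro i j (hi | hj)
    · have hc : dP (i + 1) (dP (j + 1) f) = dP (j + 1) (dP (i + 1) f) := dP_comm _ _ _
      simp [hc, (h (i + 1) (by omega)).1]
    · simp [(h (j + 1) (by omega)).1]

lemma LamY_eq_sum (h : DerivBound N f) :
    LamY f =
      alpha • (∑ i ∈ Finset.range N, ∑ j ∈ Finset.range N,
        ((i + 1 : ℕ) : K) • (Y (i + j + 1) * dP (i + 1) (dY j f)))
      + (∑ i ∈ Finset.range N, ∑ j ∈ Finset.range N, Y i * P (j + 1) * dY (i + j + 1) f)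
      + bb • (∑ i ∈ Finset.range N, ((i + 1 : ℕ) : K) • (Y (i + 1) * dY (i + 1) f)) := by
  unfold LamY
  rw [finsum_finsum_eq_sum_range (N := N), finsum_finsum_eq_sum_range (N := N),
    finsum_eq_sum_range (N := N)]
  · intro i hi
    simp [(h (i + 1) (by omega)).2]
  · intro i j hij
    simp [(h (i + j + 1) (by omega)).2]
  · rintro i j (hi | hj)
    · simp [dP_dY_comm, (h (i + 1) (by omega)).1]
    · simp [(h j (by omega)).2]

lemma D'alpha_eq_sum (h : DerivBound N f) :
    D'alpha f =
      alpha • (∑ i ∈ Finset.range N, ∑ j ∈ Finset.range N, (((i + 1) * (j + 1) : ℕ) : K) •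
        (Y (i + 1 + (j + 1)) * dY (i + 1) (dP (j + 1) f)))
      + (∑ i ∈ Finset.range N, ∑ j ∈ Finset.range N,
        ((i + 1 : ℕ) : K) • (Y (i + 1) * P (j + 1) * dY (i + 1 + (j + 1)) f))
      + (bb * (2 : K)⁻¹) • (∑ i ∈ Finset.range N,
        (((i + 1) * i : ℕ) : K) • (Y (i + 1) * dY (i + 1) f)) := by
  unfold D'alpha
  rw [finsum_finsum_eq_sum_range (N := N), finsum_finsum_eq_sum_range (N := N),
    finsum_eq_sum_range (N := N)]
  · intro i hi
    simp [(h (i + 1) (by omega)).2]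
  · intro i j hij
    simp [(h (i + 1 + (j + 1)) (by omega)).2]
  · rintro i j (hi | hj)
    · simp [← dP_dY_comm, (h (i + 1) (by omega)).2]
    · simp [(h (j + 1) (by omega)).1]

lemma DerivBound.add {g : R} (hf : DerivBound N f) (hg : DerivBound N g) :
    DerivBound N (f + g) := fun i hi => by simp [hf i hi, hg i hi]

lemma DerivBound.smul (hf : DerivBound N f) (c : K) :
    DerivBound N (c • f) := fun i hi => by simp [hf i hi]

lemma exists_common_derivBound (f g : R) : ∃ N, DerivBound N f ∧ DerivBound N g := by
  obtain ⟨M, hM⟩ := exists_derivBound f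
  obtain ⟨N, hN⟩ := exists_derivBound g
  exact ⟨max M N, hM.mono (le_max_left _ _), hN.mono (le_max_right _ _)⟩

lemma isLinearMap_Yplus : IsLinearMap K Yplus where
  map_add f g := by
    obtain ⟨N, hf, hg⟩ := exists_common_derivBound f g
    simp only [Yplus_eq_sum hf, Yplus_eq_sum hg, Yplus_eq_sum (hf.add hg), dY_add, mul_add,
      Finset.sum_add_distrib]
  map_smul c f := by
    obtain ⟨N, hf⟩ := exists_derivBound f
    simp only [Yplus_eq_sum hf, Yplus_eq_sum (hf.smul c), dY_smul, mul_smul_comm,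
      Finset.smul_sum]

lemma isLinearMap_Dalpha : IsLinearMap K Dalpha where
  map_add f g := by
    obtain ⟨N, hf, hg⟩ := exists_common_derivBound f g
    simp only [Dalpha_eq_sum hf, Dalpha_eq_sum hg, Dalpha_eq_sum (hf.add hg), dP_add, mul_add,
      Finset.sum_add_distrib, smul_add]
    abel
  map_smul c f := by
    obtain ⟨N, hf⟩ := exists_derivBound f
    simp only [Dalpha_eq_sum hf, Dalpha_eq_sum (hf.smul c), dP_smul, mul_smul_comm,
      Finset.smul_sum, smul_add, smul_comm _ c]

lemma isLinearMap_LamY : IsLinearMap K LamY where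
  map_add f g := by
    obtain ⟨N, hf, hg⟩ := exists_common_derivBound f g
    simp only [LamY_eq_sum hf, LamY_eq_sum hg, LamY_eq_sum (hf.add hg), dP_add, dY_add, mul_add,
      Finset.sum_add_distrib, smul_add]
    abel
  map_smul c f := by
    obtain ⟨N, hf⟩ := exists_derivBound f
    simp only [LamY_eq_sum hf, LamY_eq_sum (hf.smul c), dP_smul, dY_smul, mul_smul_comm,
      Finset.smul_sum, smul_add, smul_comm _ c]

lemma isLinearMap_D'alpha : IsLinearMap K D'alpha where
  map_add f g := by
    obtain ⟨N, hf, hg⟩ := exists_common_derivBound f g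
    simp only [D'alpha_eq_sum hf, D'alpha_eq_sum hg, D'alpha_eq_sum (hf.add hg), dP_add, dY_add,
      mul_add, Finset.sum_add_distrib, smul_add]
    abel
  map_smul c f := by
    obtain ⟨N, hf⟩ := exists_derivBound f
    simp only [D'alpha_eq_sum hf, D'alpha_eq_sum (hf.smul c), dP_smul, dY_smul, mul_smul_comm,
      Finset.smul_sum, smul_add, smul_comm _ c]

lemma Yplus_sum {ι : Type*} (s : Finset ι) (g : ι → R) :
    Yplus (∑ i ∈ s, g i) = ∑ i ∈ s, Yplus (g i) :=
  map_sum isLinearMap_Yplus.mk' g s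

namespace YFree

lemma derivBound_Y_mul (hf : YFree f) (h : DerivBound N f) {k : ℕ} (hk : k < N) :
    DerivBound N (Y k * f) := fun i hi => by
  rw [dP_Y_mul, (h i hi).1, mul_zero, hf.dY_Y_mul, if_neg (by omega)]
  exact ⟨rfl, rfl⟩

lemma Yplus_eq_zero (hf : YFree f) : Yplus f = 0 := by
  simp [Yplus, hf _]

lemma LamY_eq_zero (hf : YFree f) : LamY f = 0 := by
  simp [LamY, hf _]

lemma D'alpha_eq_zero (hf : YFree f) : D'alpha f = 0 := by
  simp [D'alpha, hf _, hf.dP _ _]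

lemma Dalpha (hf : YFree f) : YFree (Dalpha f) := by
  obtain ⟨N, h⟩ := exists_derivBound f
  rw [Dalpha_eq_sum h]
  simp only [mul_assoc]
  exact ((((sum fun i => sum fun j => (((hf.dP _).dP _).P_mul _).smul _).smul _).add
    (sum fun i => sum fun j => (((hf.dP _).P_mul _).P_mul _).smul _)).add
    ((sum fun i => ((hf.dP _).P_mul _).smul _).smul _)).smul _

lemma Yplus_Y_mul (hf : YFree f) (k : ℕ) : Yplus (Y k * f) = Y (k + 1) * f := by
  unfold Yplus
  rw [finsum_eq_single _ k fun i hi => by rw [hf.dY_Y_mul, if_neg hi, mul_zero],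
    hf.dY_Y_mul, if_pos rfl]

lemma Dalpha_Y_mul (hf : YFree f) (k : ℕ) : _root_.Dalpha (Y k * f) = Y k * _root_.Dalpha f := by
  obtain ⟨M, hM⟩ := exists_derivBound f
  have h := hM.mono (le_max_left M (k + 1))
  rw [Dalpha_eq_sum h, Dalpha_eq_sum (hf.derivBound_Y_mul h (by omega))]
  simp only [dP_Y_mul, mul_left_comm _ (Y k), mul_smul_comm, Finset.mul_sum, mul_add]

/-- Closed form of `LamY` on a monomial linear in the `y`-variables. -/
lemma LamY_Y_mul (hf : YFree f) (h : DerivBound N f) {k : ℕ} (hk : k < N) :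
    LamY (Y k * f) =
      alpha • (∑ j ∈ Finset.range N, ((j + 1 : ℕ) : K) • (Y (k + j + 1) * _root_.dP (j + 1) f))
      + (∑ j ∈ Finset.range N, ∑ i ∈ Finset.range N,
        if i + j + 1 = k then Y i * (P (j + 1) * f) else 0)
      + bb • ((k : K) • (Y k * f)) := by
  rw [LamY_eq_sum (hf.derivBound_Y_mul h hk)]
  congr 1
  · congr 1
    · congr 1
      refine Finset.sum_congr rfl fun i _ => ?_
      rw [Finset.sum_eq_single_of_mem k (Finset.mem_range.mpr hk)]
      · rw [hf.dY_Y_mul, if_pos rfl, add_comm i k]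
      · intro j _ hj
        rw [hf.dY_Y_mul, if_neg hj, dP_zero, mul_zero, smul_zero]
    · rw [Finset.sum_comm]
      refine Finset.sum_congr rfl fun j _ => Finset.sum_congr rfl fun i _ => ?_
      rw [hf.dY_Y_mul, mul_ite, mul_zero, mul_assoc]
  · congr 1
    rcases k with _ | k
    · simp [hf.dY_Y_mul]
    · rw [Finset.sum_eq_single_of_mem k (Finset.mem_range.mpr (by omega))]
      · rw [hf.dY_Y_mul, if_pos rfl]
      · intro j _ hj
        rw [hf.dY_Y_mul, if_neg (by omega), mul_zero, smul_zero]

/-- Closed form of `D'alpha` on a monomial linear in the `y`-variables. -/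
lemma D'alpha_Y_mul (hf : YFree f) (h : DerivBound N f) {k : ℕ} (hk : k < N) :
    D'alpha (Y k * f) =
      alpha • (∑ j ∈ Finset.range N,
        ((k * (j + 1) : ℕ) : K) • (Y (k + j + 1) * _root_.dP (j + 1) f))
      + (∑ j ∈ Finset.range N, ∑ i ∈ Finset.range N,
        if i + j + 2 = k then ((i + 1 : ℕ) : K) • (Y (i + 1) * (P (j + 1) * f)) else 0)
      + (bb * (2 : K)⁻¹) • ((k * (k - 1) : K) • (Y k * f)) := by
  rw [D'alpha_eq_sum (hf.derivBound_Y_mul h hk)]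
  congr 1
  · congr 1
    · congr 1
      rw [Finset.sum_comm]
      refine Finset.sum_congr rfl fun j _ => ?_
      simp only [dP_Y_mul, (hf.dP _).dY_Y_mul]
      rcases k with _ | k
      · simp
      · rw [Finset.sum_eq_single_of_mem k (Finset.mem_range.mpr (by omega))]
        · rw [if_pos rfl, add_assoc (k + 1)]
        · intro i _ hi
          rw [if_neg (by omega), mul_zero, smul_zero]
    · rw [Finset.sum_comm]
      refine Finset.sum_congr rfl fun j _ => Finset.sum_congr rfl fun i _ => ?_
      rw [hf.dY_Y_mul, mul_ite, mul_zero, mul_assoc, smul_ite, smul_zero]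
      exact if_congr (by omega) rfl rfl
  · congr 1
    rcases k with _ | k
    · simp [hf.dY_Y_mul]
    · rw [Finset.sum_eq_single_of_mem k (Finset.mem_range.mpr (by omega))]
      · rw [hf.dY_Y_mul, if_pos rfl]
        push_cast
        rw [add_sub_cancel_right]
      · intro j _ hj
        rw [hf.dY_Y_mul, if_neg (by omega), mul_zero, smul_zero]

lemma D'alpha_Yplus_Y_mul (hf : YFree f) (k : ℕ) :
    D'alpha (Y (k + 1) * f) = Yplus (D'alpha (Y k * f)) + Yplus (LamY (Y k * f)) := by
  obtain ⟨M, hM⟩ := exists_derivBound f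
  obtain ⟨N, hMN, hN⟩ : ∃ N, M ≤ N ∧ k + 1 < N := ⟨max M (k + 2), by omega, by omega⟩
  have h := hM.mono hMN
  have hk : k < N := by omega
  have hite : ∀ (p : Prop) [Decidable p] (g : R),
      Yplus (if p then g else 0) = if p then Yplus g else 0 := fun p _ g => by
    split_ifs
    · rfl
    · exact isLinearMap_Yplus.map_zero
  rw [hf.D'alpha_Y_mul h hN, hf.D'alpha_Y_mul h hk, hf.LamY_Y_mul h hk]
  simp only [isLinearMap_Yplus.map_add, isLinearMap_Yplus.map_smul, Yplus_sum, hite,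
    (hf.dP _).Yplus_Y_mul, (hf.P_mul _).Yplus_Y_mul, hf.Yplus_Y_mul]
  have h1 : ∑ j ∈ Finset.range N,
        (((k + 1) * (j + 1) : ℕ) : K) • (Y (k + 1 + j + 1) * _root_.dP (j + 1) f)
      = ∑ j ∈ Finset.range N, ((k * (j + 1) : ℕ) : K) • (Y (k + j + 1 + 1) * _root_.dP (j + 1) f)
      + ∑ j ∈ Finset.range N, ((j + 1 : ℕ) : K) • (Y (k + j + 1 + 1) * _root_.dP (j + 1) f) := by
    rw [← Finset.sum_add_distrib]
    refine Finset.sum_congr rfl fun j _ => ?_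
    rw [← add_smul, ← Nat.cast_add, ← Nat.succ_mul, add_right_comm k 1 j]
  have h2 : ∑ j ∈ Finset.range N, ∑ i ∈ Finset.range N,
        (if i + j + 2 = k + 1 then ((i + 1 : ℕ) : K) • (Y (i + 1) * (P (j + 1) * f)) else 0)
      = ∑ j ∈ Finset.range N, ∑ i ∈ Finset.range N,
        (if i + j + 2 = k then ((i + 1 : ℕ) : K) • (Y (i + 1 + 1) * (P (j + 1) * f)) else 0)
      + ∑ j ∈ Finset.range N, ∑ i ∈ Finset.range N,
        (if i + j + 1 = k then Y (i + 1) * (P (j + 1) * f) else 0) := by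
    rw [← Finset.sum_add_distrib]
    refine Finset.sum_congr rfl fun j _ => ?_
    let g : ℕ → R := fun i => if i + j + 1 = k then Y (i + 1) * (P (j + 1) * f) else 0
    have hg : ∑ i ∈ Finset.range N, ((i : ℕ) : K) • g i
        = ∑ i ∈ Finset.range N, ((i + 1 : ℕ) : K) • g (i + 1) := by
      have := Finset.sum_range_succ (fun i => ((i : ℕ) : K) • g i) N
      rw [Finset.sum_range_succ'] at this
      have hgN : g N = 0 := if_neg (by omega)
      simpa [hgN] using this.symm
    calc _ = ∑ i ∈ Finset.range N, (((i : ℕ) : K) • g i + g i) := by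
          refine Finset.sum_congr rfl fun i _ => ?_
          by_cases hi : i + j + 1 = k
          · simp [g, hi, add_smul]
          · simp [g, hi]
      _ = _ := by
          rw [Finset.sum_add_distrib, hg]
          congr 1
          refine Finset.sum_congr rfl fun i _ => ?_
          rw [smul_ite, smul_zero]
          exact if_congr (by omega) rfl rfl
  have h3 : (bb * (2 : K)⁻¹) • ((((k + 1 : ℕ) : K) * ((k + 1 : ℕ) - 1)) • (Y (k + 1) * f))
      = (bb * (2 : K)⁻¹) • (((k : K) * (k - 1)) • (Y (k + 1) * f))
      + bb • ((k : K) • (Y (k + 1) * f)) := by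
    simp only [smul_smul, ← add_smul]
    congr 1
    push_cast
    field_simp
    ring
  rw [h1, h2, h3, smul_add]
  abel

end YFree

end

/-- `[D_α + D′_α, Y_+] = Y_+ Λ_Y` on `𝒫_Y` (relation (4.4b) of Chapuy–Dołęga). -/
theorem commutator_D_Yplus :
    ∀ f ∈ PY, (Dalpha (Yplus f) + D'alpha (Yplus f)) - Yplus (Dalpha f + D'alpha f)
      = Yplus (LamY f) := by
  intro f hf
  induction hf using Submodule.span_induction with
  | mem f hf =>
    rcases hf with hf | ⟨k, g, hg, rfl⟩
    · have hf := yFree_of_mem_Psub hf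
      rw [hf.Yplus_eq_zero, hf.D'alpha_eq_zero, hf.LamY_eq_zero, add_zero,
        hf.Dalpha.Yplus_eq_zero, isLinearMap_Dalpha.map_zero, isLinearMap_D'alpha.map_zero,
        isLinearMap_Yplus.map_zero, add_zero, sub_zero]
    · have hg := yFree_of_mem_Psub hg
      rw [hg.Yplus_Y_mul, isLinearMap_Yplus.map_add, hg.Dalpha_Y_mul, hg.Dalpha_Y_mul,
        hg.Dalpha.Yplus_Y_mul, hg.D'alpha_Yplus_Y_mul]
      abel
  | zero =>
    simp only [isLinearMap_Dalpha.map_zero, isLinearMap_D'alpha.map_zero,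
      isLinearMap_Yplus.map_zero, isLinearMap_LamY.map_zero, add_zero, sub_zero]
  | add f g _ _ hf hg =>
    simp only [isLinearMap_Dalpha.map_add, isLinearMap_D'alpha.map_add,
      isLinearMap_Yplus.map_add, isLinearMap_LamY.map_add] at hf hg ⊢
    rw [← hf, ← hg]
    abel
  | smul c f _ hf =>
    simp only [isLinearMap_Dalpha.map_smul, isLinearMap_D'alpha.map_smul,
      isLinearMap_Yplus.map_smul, isLinearMap_LamY.map_smul, ← smul_add, ← smul_sub, hf]
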